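/- Localization lemma: let h^reg = {v ∈ h | W_v = 1} and let δ ∈ ℂ[h]^W have zero set h∖h^reg. Then the Dunkl homomorphism H_c → D(h^reg)#W, given on generators by x ↦ x, w ↦ w, y ↦ y + Σ_{s∈S} (2c(s)⟨α_s,y⟩/((1−λ_s)α_s))(s−1), induces an isomorphism H_c[δ^{-1}] ≅ D(h^reg)#W. -/

import Mathlib

/-! Core definitions: complex reflection groups, rational Cherednik algebras,
and their categories 𝒪. -/

noncomputable section

open Module Function

/-- A (complex) reflection: a linear automorphism `g` with `rank (g - 1) = 1`. -/
def IsComplexReflection {V : Type} [AddCommGroup V] [Module ℂ V]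
    (g : V ≃ₗ[ℂ] V) : Prop :=
  Module.finrank ℂ (LinearMap.range (g.toLinearMap - LinearMap.id)) = 1

variable (V : Type) [AddCommGroup V] [Module ℂ V] [FiniteDimensional ℂ V]

/-- A finite complex reflection group on a finite dimensional complex vector
space `V`: a finite subgroup of `GL(V)` generated by its reflections. -/
structure CRG where
  W : Subgroup (V ≃ₗ[ℂ] V)
  finite : Finite W
  gen : Subgroup.closure {g : V ≃ₗ[ℂ] V | g ∈ W ∧ IsComplexReflection g} = W

variable {V}

/-- The set `S` of reflections in `W`. -/
def CRG.Refl (G : CRG V) : Type :=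
  {s : G.W // IsComplexReflection (s : V ≃ₗ[ℂ] V)}

instance (G : CRG V) : CoeOut G.Refl G.W := ⟨fun s => s.1⟩

/-- Conjugation invariance of a parameter `c : S → ℂ`. -/
def IsConjInvariant {G : CRG V} (c : G.Refl → ℂ) : Prop :=
  ∀ s t : G.Refl, (∃ g : G.W, t.1 = g * s.1 * g⁻¹) → c t = c s

/-- For each reflection `s`: eigenvectors `α_s ∈ h*`, `α_s^∨ ∈ h` for `s` with
eigenvalue different from `1`, normalized by `⟨α_s, α_s^∨⟩ = 2`; `lam s` is the
eigenvalue of `s` on `h*` different from `1`. -/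
structure ReflData (G : CRG V) where
  α : G.Refl → Module.Dual ℂ V
  αv : G.Refl → V
  lam : G.Refl → ℂ
  lam_ne_one : ∀ s, lam s ≠ 1
  α_ne : ∀ s, α s ≠ 0
  αv_ne : ∀ s, αv s ≠ 0
  eig_α : ∀ (s : G.Refl) (v : V),
    α s (((s.1 : V ≃ₗ[ℂ] V)).symm v) = lam s * α s v
  eig_αv : ∀ s : G.Refl, ∃ μ : ℂ, μ ≠ 1 ∧ ((s.1 : V ≃ₗ[ℂ] V)) (αv s) = μ • αv s
  pairing : ∀ s, α s (αv s) = 2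

/-- The rational Cherednik algebra `H_c(W)`: the quotient of `T(h ⊕ h*)#W` by
the commutation relations, presented via its universal property. -/
structure RCA (G : CRG V) (D : ReflData G) (c : G.Refl → ℂ) where
  H : Type
  [ring : Ring H]
  [alg : Algebra ℂ H]
  x : Module.Dual ℂ V →ₗ[ℂ] H
  y : V →ₗ[ℂ] H
  w : G.W →* H
  comm_x : ∀ a b, x a * x b = x b * x a
  comm_y : ∀ u v, y u * y v = y v * y u
  w_x : ∀ (g : G.W) (a : Module.Dual ℂ V),
    w g * x a = x (a ∘ₗ (((g⁻¹ : G.W) : V ≃ₗ[ℂ] V) : V →ₗ[ℂ] V)) * w g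
  w_y : ∀ (g : G.W) (v : V), w g * y v = y (((g : V ≃ₗ[ℂ] V)) v) * w g
  rel : ∀ (v : V) (a : Module.Dual ℂ V),
    y v * x a - x a * y v =
      algebraMap ℂ H (a v) -
        ∑ᶠ s : G.Refl, (c s * D.α s v * a (D.αv s)) • w s.1
  universal : ∀ (A : Type) [Ring A] [Algebra ℂ A]
      (xA : Module.Dual ℂ V →ₗ[ℂ] A) (yA : V →ₗ[ℂ] A) (wA : G.W →* A),
      (∀ a b, xA a * xA b = xA b * xA a) →
      (∀ u v, yA u * yA v = yA v * yA u) →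
      (∀ (g : G.W) (a : Module.Dual ℂ V),
        wA g * xA a = xA (a ∘ₗ (((g⁻¹ : G.W) : V ≃ₗ[ℂ] V) : V →ₗ[ℂ] V)) * wA g) →
      (∀ (g : G.W) (v : V), wA g * yA v = yA (((g : V ≃ₗ[ℂ] V)) v) * wA g) →
      (∀ (v : V) (a : Module.Dual ℂ V),
        yA v * xA a - xA a * yA v =
          algebraMap ℂ A (a v) -
            ∑ᶠ s : G.Refl, (c s * D.α s v * a (D.αv s)) • wA s.1) →
      ∃! φ : H →ₐ[ℂ] A,
        (∀ a, φ (x a) = xA a) ∧ (∀ v, φ (y v) = yA v) ∧ (∀ g, φ (w g) = wA g)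

attribute [instance] RCA.ring RCA.alg

variable {G : CRG V} {D : ReflData G} {c : G.Refl → ℂ}

/-- The category `𝒪_c(W)`: modules over `H_c` which are finitely generated and
on which `h` acts locally nilpotently. -/
structure CatO (R : RCA G D c) where
  M : Type
  [ab : AddCommGroup M]
  [mod : Module R.H M]
  locNilp : ∀ m : M, ∃ N : ℕ, ∀ L : List V, L.length = N →
    (L.map fun v => R.y v).prod • m = 0
  fg : Module.Finite R.H M

attribute [instance] CatO.ab CatO.mod

instance catO (R : RCA G D c) : CategoryTheory.Category (CatO R) where
  Hom A B := A.M →ₗ[R.H] B.M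
  id A := LinearMap.id
  comp f g := g.comp f
  id_comp f := LinearMap.comp_id f
  comp_id f := LinearMap.id_comp f
  assoc f g h := (LinearMap.comp_assoc _ _ _).symm

/-- A finite dimensional representation of `W`. -/
structure WRep (G : CRG V) where
  T : Type
  [ab : AddCommGroup T]
  [mod : Module ℂ T]
  [fd : FiniteDimensional ℂ T]
  ρ : G.W →* (T ≃ₗ[ℂ] T)

attribute [instance] WRep.ab WRep.mod WRep.fd

/-- Irreducibility of a representation of `W`. -/
def WRep.IsIrr {G : CRG V} (τ : WRep G) : Prop :=
  Nontrivial τ.T ∧ ∀ U : Submodule ℂ τ.T,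
    (∀ (g : G.W) (t : τ.T), t ∈ U → τ.ρ g t ∈ U) → U = ⊥ ∨ U = ⊤

/-- Isomorphism of representations of `W`. -/
def WRep.Iso {G : CRG V} (τ τ' : WRep G) : Prop :=
  ∃ e : τ.T ≃ₗ[ℂ] τ'.T, ∀ (g : G.W) (t : τ.T), e (τ.ρ g t) = τ'.ρ g (e t)

/-- `M`, together with the lowest weight inclusion `ι : τ → M`, is the Verma
module `Δ_c(τ) = H_c ⊗_{S(h)#W} τ`, presented via its universal property. -/
structure VermaStr (R : RCA G D c) (τ : WRep G) (M : Type) [AddCommGroup M]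
    [Module R.H M] where
  ι : τ.T →+ M
  ι_smul : ∀ (a : ℂ) (t : τ.T), ι (a • t) = algebraMap ℂ R.H a • ι t
  ι_y : ∀ (v : V) (t : τ.T), R.y v • ι t = 0
  ι_w : ∀ (g : G.W) (t : τ.T), R.w g • ι t = ι (τ.ρ g t)
  universal : ∀ (N : Type) [AddCommGroup N] [Module R.H N] (κ : τ.T →+ N),
      (∀ (a : ℂ) (t : τ.T), κ (a • t) = algebraMap ℂ R.H a • κ t) →
      (∀ (v : V) (t : τ.T), R.y v • κ t = 0) →
      (∀ (g : G.W) (t : τ.T), R.w g • κ t = κ (τ.ρ g t)) →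
      ∃! φ : M →ₗ[R.H] N, ∀ t, φ (ι t) = κ t

/-- A greatest proper submodule (so the quotient is the unique simple
quotient). -/
def IsGreatestProper {A : Type} [Ring A] {M : Type} [AddCommGroup M]
    [Module A M] (N : Submodule A M) : Prop :=
  N ≠ ⊤ ∧ ∀ N' : Submodule A M, N' ≠ ⊤ → N' ≤ N

end

section Stmt9
noncomputable section

open Module

variable {V : Type} [AddCommGroup V] [Module ℂ V] [FiniteDimensional ℂ V]

/-- The stabilizer `W_v ⊂ W` of a point `v ∈ h`. -/
def stabIn (G : CRG V) (v : V) : Subgroup G.W :=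
  (MulAction.stabilizer (V ≃ₗ[ℂ] V) v).comap G.W.subtype

/-- `ℂ[h]`, realized as polynomials in the dual basis of a basis of `h`. -/
abbrev PolyV (n : ℕ) : Type := MvPolynomial (Fin n) ℂ

/-- The action of `g ∈ W` on polynomial functions, `(g·f)(v) = f(g⁻¹v)`. -/
def polyAct {G : CRG V} {n : ℕ} (b : Basis (Fin n) ℂ V) (g : G.W) :
    PolyV n →ₐ[ℂ] PolyV n :=
  MvPolynomial.aeval fun i =>
    ∑ j, (b.coord i (((g⁻¹ : G.W) : V ≃ₗ[ℂ] V) (b j))) • MvPolynomial.X j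

/-- The linear polynomial representing a linear functional `a ∈ h*`. -/
def dualPoly {n : ℕ} (b : Basis (Fin n) ℂ V) (a : Module.Dual ℂ V) :
    PolyV n :=
  ∑ i, MvPolynomial.C (a (b i)) * MvPolynomial.X i

/-- `ℂ[h^reg] = ℂ[h][δ⁻¹]`. -/
def LocReg {n : ℕ} (δP : PolyV n) : Type := Localization.Away δP

instance {n : ℕ} (δP : PolyV n) : CommRing (LocReg δP) :=
  inferInstanceAs (CommRing (Localization.Away δP))

instance {n : ℕ} (δP : PolyV n) : Algebra (PolyV n) (LocReg δP) :=
  inferInstanceAs (Algebra (PolyV n) (Localization.Away δP))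

instance {n : ℕ} (δP : PolyV n) : Algebra ℂ (LocReg δP) :=
  ((algebraMap (PolyV n) (LocReg δP)).comp (algebraMap ℂ (PolyV n))).toAlgebra

open MvPolynomial IsMulCommutative in
theorem MvPolynomial.exists_algHom_of_commute {R A ι : Type*} [CommRing R] [Ring A] [Algebra R A]
    (a : ι → A) (ha : ∀ i j, a i * a j = a j * a i) :
    ∃ φ : MvPolynomial ι R →ₐ[R] A, ∀ i, φ (X i) = a i := by
  have hcomm : ∀ u ∈ Set.range a, ∀ v ∈ Set.range a, u * v = v * u := by
    rintro _ ⟨i, rfl⟩ _ ⟨j, rfl⟩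
    exact ha i j
  have := Algebra.isMulCommutative_adjoin R hcomm
  let f : ι → Algebra.adjoin R (Set.range a) := fun i => ⟨a i, Algebra.subset_adjoin ⟨i, rfl⟩⟩
  exact ⟨(Algebra.adjoin R (Set.range a)).val.comp (aeval f), fun i => by simp [f]⟩

/-- Polynomials all of whose monomials have degree smaller than `d`. -/
def MvPolynomial.degreeLT (σ R : Type*) [CommSemiring R] (d : ℕ) :
    Submodule R (MvPolynomial σ R) where
  carrier := {q | ∀ γ, q.coeff γ ≠ 0 → γ.degree < d}
  zero_mem' := by simp
  add_mem' {p q} hp hq γ h := by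
    by_contra hd
    have h1 : p.coeff γ = 0 := by_contra fun h => hd (hp γ h)
    have h2 : q.coeff γ = 0 := by_contra fun h => hd (hq γ h)
    exact h (by simp [h1, h2])
  smul_mem' a q hq γ h := hq γ fun h0 => h (by simp [h0])

namespace MvPolynomial

variable {σ R : Type*} [CommSemiring R]

theorem exists_mem_degreeLT (q : MvPolynomial σ R) : ∃ d, q ∈ degreeLT σ R d := by
  refine ⟨q.totalDegree + 1, fun γ hγ => Nat.lt_succ_of_le ?_⟩
  have := le_totalDegree (mem_support_iff.2 hγ)
  rwa [Finsupp.sum, ← Finsupp.degree_apply] at this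

theorem eq_zero_of_mem_degreeLT_zero {q : MvPolynomial σ R} (hq : q ∈ degreeLT σ R 0) :
    q = 0 := by
  ext γ
  by_contra h
  exact absurd (hq γ h) (Nat.not_lt_zero _)

theorem monomial_mem_degreeLT {d : ℕ} {γ : σ →₀ ℕ} (hγ : γ.degree < d) (u : R) :
    monomial γ u ∈ degreeLT σ R d := by
  classical
  intro β h
  rw [coeff_monomial] at h
  split_ifs at h with h'
  · exact h' ▸ hγ
  · exact absurd rfl h

theorem pderiv_mem_degreeLT {d : ℕ} {q : MvPolynomial σ R} (hq : q ∈ degreeLT σ R (d + 1))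
    (i : σ) : pderiv i q ∈ degreeLT σ R d := by
  intro γ h
  rw [coeff_pderiv] at h
  have := hq (γ + Finsupp.single i 1) fun h0 => h (by simp [h0])
  rw [map_add, Finsupp.degree_single] at this
  omega

theorem eq_C_of_pderiv_eq_zero {R : Type*} [CommRing R] [IsDomain R] [CharZero R]
    {q : MvPolynomial σ R} (hq : ∀ i, pderiv i q = 0) : q = C (q.coeff 0) := by
  classical
  ext γ
  rw [coeff_C]
  split_ifs with h
  · rw [h]
  · obtain ⟨i, hi⟩ : ∃ i, γ i ≠ 0 := by
      by_contra! h'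
      exact h (Finsupp.ext fun i => (h' i).symm)
    have h1 := congrArg (coeff (γ - Finsupp.single i 1)) (hq i)
    have h2 : γ - Finsupp.single i 1 + Finsupp.single i 1 = γ :=
      tsub_add_cancel_of_le (Finsupp.single_le_iff.2 (Nat.one_le_iff_ne_zero.2 hi))
    rw [coeff_pderiv, h2, coeff_zero] at h1
    exact (mul_eq_zero.1 h1).resolve_right (Nat.cast_add_one_ne_zero _)

theorem iterate_eq_zero_of_mem_degreeLT {L : MvPolynomial σ R →ₗ[R] MvPolynomial σ R}
    (hL : ∀ d, ∀ q ∈ degreeLT σ R (d + 1), L q ∈ degreeLT σ R d) (d : ℕ)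
    {q : MvPolynomial σ R} (hq : q ∈ degreeLT σ R d) : L^[d] q = 0 := by
  induction d generalizing q with
  | zero => exact eq_zero_of_mem_degreeLT_zero hq
  | succ d ih => exact ih (hL d q hq)

theorem eq_zero_of_smul_add_eq_zero {R : Type*} [CommRing R] [IsDomain R]
    {L : MvPolynomial σ R →ₗ[R] MvPolynomial σ R}
    (hL : ∀ d, ∀ q ∈ degreeLT σ R (d + 1), L q ∈ degreeLT σ R d)
    {u : R} (hu : u ≠ 0) {q : MvPolynomial σ R} (h : u • q + L q = 0) : q = 0 := by
  obtain ⟨d, hd⟩ := exists_mem_degreeLT q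
  refine eq_zero_of_mem_degreeLT_zero ?_
  induction d with
  | zero => exact hd
  | succ d ih =>
    refine ih fun γ hγ => ?_
    have h1 : (u • q) ∈ degreeLT σ R d := by
      rw [eq_neg_of_add_eq_zero_left h]
      exact neg_mem (hL d q hd)
    exact h1 γ (by simpa using ⟨hu, hγ⟩)

theorem monomial_add_single_induction {P : (σ →₀ ℕ) → Prop} (zero : P 0)
    (add : ∀ i β, P β → P (Finsupp.single i 1 + β)) (β : σ →₀ ℕ) : P β := by
  induction β using Finsupp.induction with
  | zero => exact zero
  | single_add i k β _ _ ih =>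
    induction k with
    | zero => simpa using ih
    | succ k ihk =>
      by_cases hk : k = 0
      · subst hk
        simpa using add i β ih
      · have := add i _ (ihk hk)
        rwa [← add_assoc, ← Finsupp.single_add, add_comm 1 k] at this

end MvPolynomial

section TwistedOperators

open MvPolynomial

variable {K : Type*} [CommRing K] [IsDomain K] [Algebra ℂ K] {n : ℕ}
  {W : Type*} [Fintype W]

theorem normalOrdered_injective (x : Fin n → K)
    (S : MvPolynomial (Fin n) K →ₗ[K] Module.End ℂ K)
    (hSC : ∀ u, S (C u) = LinearMap.mulLeft ℂ u)
    (hSx : ∀ q j, S q * LinearMap.mulLeft ℂ (x j) = x j • S q + S (pderiv j q))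
    {q : MvPolynomial (Fin n) K} (hq : S q = 0) : q = 0 := by
  have : CharZero K := charZero_of_injective_algebraMap (algebraMap ℂ K).injective
  obtain ⟨d, hd⟩ := exists_mem_degreeLT q
  induction d generalizing q with
  | zero => exact eq_zero_of_mem_degreeLT_zero hd
  | succ d ih =>
    have h1 := eq_C_of_pderiv_eq_zero (q := q) fun j => by
      refine ih ?_ (pderiv_mem_degreeLT hd j)
      simpa [hq] using (hSx q j).symm
    rw [h1, hSC] at hq
    have := LinearMap.congr_fun hq 1
    rw [h1]
    simpa using this

/-- Operators `∑_g P_g g` with `P_g` normally ordered differential operators determine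
their coefficients. -/
theorem twistedOperator_injective (x : Fin n → K)
    (S : MvPolynomial (Fin n) K →ₗ[K] Module.End ℂ K)
    (hSC : ∀ u, S (C u) = LinearMap.mulLeft ℂ u)
    (hSx : ∀ q j, S q * LinearMap.mulLeft ℂ (x j) = x j • S q + S (pderiv j q))
    (σ : W → Module.End ℂ K) (hσu : ∀ g, IsUnit (σ g)) (m : W → Fin n → Fin n → ℂ)
    (hσx : ∀ g i, σ g * LinearMap.mulLeft ℂ (x i) =
      LinearMap.mulLeft ℂ (∑ j, m g i j • x j) * σ g)
    (hσ : ∀ g h, g ≠ h → ∃ i, ∑ j, m g i j • x j ≠ ∑ j, m h i j • x j)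
    (q : W → MvPolynomial (Fin n) K) (hq : ∑ g, S (q g) * σ g = 0) : q = 0 := by
  classical
  set y : W → Fin n → K := fun g i => ∑ j, m g i j • x j with hy
  let L : W → Fin n → (MvPolynomial (Fin n) K →ₗ[K] MvPolynomial (Fin n) K) := fun g i =>
    ∑ j, algebraMap ℂ K (m g i j) • (pderiv j).toLinearMap
  have hL : ∀ g i d, ∀ q ∈ degreeLT (Fin n) K (d + 1), L g i q ∈ degreeLT (Fin n) K d := by
    intro g i d q hq
    simp only [L, LinearMap.sum_apply, LinearMap.smul_apply]
    exact sum_mem fun j _ => Submodule.smul_mem _ _ (pderiv_mem_degreeLT hq j)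
  have hSL : ∀ g i q, S q * LinearMap.mulLeft ℂ (y g i) = y g i • S q + S (L g i q) := by
    intro g i q
    have h1 : LinearMap.mulLeft ℂ (y g i) = ∑ j, m g i j • LinearMap.mulLeft ℂ (x j) := by
      ext u
      simp [hy, Finset.sum_mul]
    rw [h1, Finset.mul_sum]
    simp only [L, LinearMap.sum_apply, LinearMap.smul_apply, map_sum, map_smul]
    rw [hy, Finset.sum_smul, ← Finset.sum_add_distrib]
    refine Finset.sum_congr rfl fun j _ => ?_
    rw [mul_smul_comm, hSx, smul_add, algebraMap_smul, smul_assoc]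
    rfl
  let A : Fin n → K → (W → MvPolynomial (Fin n) K) → (W → MvPolynomial (Fin n) K) :=
    fun i u q g => (y g i - u) • q g + L g i (q g)
  have hA : ∀ i u q, ∑ g, S (q g) * σ g = 0 → ∑ g, S (A i u q g) * σ g = 0 := by
    intro i u q hq
    have h1 : ∑ g, S (A i u q g) * σ g =
        (∑ g, S (q g) * σ g) * LinearMap.mulLeft ℂ (x i) - u • ∑ g, S (q g) * σ g := by
      rw [Finset.sum_mul, Finset.smul_sum, ← Finset.sum_sub_distrib]
      refine Finset.sum_congr rfl fun g _ => ?_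
      rw [mul_assoc, hσx, ← mul_assoc, hSL, map_add (S : _ →ₗ[K] _), map_smul]
      have h2 : (y g i - u) • S (q g) = y g i • S (q g) - u • S (q g) := by
        ext t
        exact sub_mul _ _ _
      rw [h2, add_mul, add_mul, sub_mul]
      have : (u • S (q g)) * σ g = u • (S (q g) * σ g) := rfl
      rw [this]
      abel
    rw [h1, hq]
    simp
  have hAiter : ∀ i u k q, ∑ g, S (q g) * σ g = 0 → ∑ g, S ((A i u)^[k] q g) * σ g = 0 := by
    intro i u k
    induction k with
    | zero => exact fun q h => h
    | succ k ih => exact fun q h => ih _ (hA i u q h)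
  have hiter : ∀ i u k q g, (A i u)^[k] q g = (fun p => (y g i - u) • p + L g i p)^[k] (q g) := by
    intro i u k
    induction k with
    | zero => exact fun q g => rfl
    | succ k ih => exact fun q g => ih _ g
  have key : ∀ g₀ (T : Finset W), g₀ ∉ T → ∀ q : W → MvPolynomial (Fin n) K, q g₀ ≠ 0 →
      ∑ g, S (q g) * σ g = 0 → ∃ q' : W → MvPolynomial (Fin n) K, q' g₀ ≠ 0 ∧
        (∀ g ∈ T, q' g = 0) ∧ ∑ g, S (q' g) * σ g = 0 := by
    intro g₀ T
    induction T using Finset.induction_on with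
    | empty => exact fun _ q h0 hq => ⟨q, h0, by simp, hq⟩
    | insert h T hT ih =>
      intro hg q h0 hq
      simp only [Finset.mem_insert, not_or] at hg
      obtain ⟨q', h0', hT', hq'⟩ := ih hg.2 q h0 hq
      obtain ⟨i, hi⟩ := hσ g₀ h hg.1
      obtain ⟨d, hd⟩ := exists_mem_degreeLT (q' h)
      refine ⟨(A i (y h i))^[d] q', ?_, ?_, hAiter _ _ _ _ hq'⟩
      · rw [hiter]
        have hne : ∀ k p, p ≠ 0 → (fun p => (y g₀ i - y h i) • p + L g₀ i p)^[k] p ≠ 0 := by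
          intro k
          induction k with
          | zero => exact fun p hp => hp
          | succ k ihk =>
            exact fun p hp => ihk _ fun h0 =>
              hp (eq_zero_of_smul_add_eq_zero (hL g₀ i) (sub_ne_zero.2 hi) h0)
        exact hne d _ h0'
      · intro g hg'
        rw [hiter]
        rcases Finset.mem_insert.1 hg' with rfl | hg'
        · simpa using iterate_eq_zero_of_mem_degreeLT (hL _ i) d hd
        · rw [hT' g hg']
          exact Function.iterate_fixed (by simp) d
  by_contra hne
  obtain ⟨g₀, hg₀⟩ : ∃ g, q g ≠ 0 := by
    by_contra! h
    exact hne (funext h)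
  obtain ⟨q', h0, hq', hE⟩ := key g₀ (Finset.univ.erase g₀) (by simp) q hg₀ hq
  rw [Finset.sum_eq_single g₀ (fun g _ hg => by rw [hq' g (by simp [hg])]; simp) (by simp)] at hE
  have hS : S (q' g₀) = 0 := by
    have := congrArg (· * ((hσu g₀).unit⁻¹ : (Module.End ℂ K)ˣ).1) hE
    simpa [mul_assoc] using this
  exact h0 (normalOrdered_injective x S hSC hSx hS)

end TwistedOperators

/-- Coordinates, commuting partial derivatives and a faithful group action by linear
substitutions on a `ℂ`-algebra `K`: the data that generate a crossed product `D(K)#W`. -/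
structure TwistedDerivations (K : Type*) [CommRing K] [Algebra ℂ K] (W : Type*) [Group W]
    (n : ℕ) where
  x : Fin n → K
  der : Fin n → Derivation ℂ K K
  der_comm : ∀ i j u, der i (der j u) = der j (der i u)
  der_x : ∀ i j, der i (x j) = if i = j then 1 else 0
  act : W →* (K ≃ₐ[ℂ] K)
  mat : W → Fin n → Fin n → ℂ
  act_x : ∀ g i, act g (x i) = ∑ j, mat g i j • x j
  dualMat : W → Fin n → Fin n → ℂ
  act_der : ∀ g i u, act g (der i u) = ∑ j, dualMat g i j • der j (act g u)
  faithful : ∀ g h, (∀ i, act g (x i) = act h (x i)) → g = h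

namespace TwistedDerivations

open MvPolynomial

variable {K : Type*} [CommRing K] [Algebra ℂ K] {W : Type*} [Group W] {n : ℕ}
  (t : TwistedDerivations K W n)

theorem exists_diffOp : ∃ φ : MvPolynomial (Fin n) ℂ →ₐ[ℂ] Module.End ℂ K,
    ∀ i, φ (X i) = (t.der i).toLinearMap :=
  exists_algHom_of_commute _ fun i j => LinearMap.ext (t.der_comm i j)

/-- The constant coefficient differential operator with a given symbol. -/
def diffOp : MvPolynomial (Fin n) ℂ →ₐ[ℂ] Module.End ℂ K := t.exists_diffOp.choose

theorem diffOp_X (i : Fin n) : t.diffOp (X i) = (t.der i).toLinearMap :=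
  t.exists_diffOp.choose_spec i

/-- The operator by which a group element acts. -/
def op (g : W) : Module.End ℂ K := (t.act g).toLinearMap

theorem op_one : t.op 1 = 1 := by
  ext u
  simp [op]

theorem op_mul (g h : W) : t.op g * t.op h = t.op (g * h) := by
  ext u
  simp [op]

theorem isUnit_op (g : W) : IsUnit (t.op g) := by
  refine ⟨⟨t.op g, t.op g⁻¹, ?_, ?_⟩, rfl⟩ <;> simp [op_mul, op_one]

theorem op_smul (g : W) (u : K) (a : Module.End ℂ K) :
    t.op g * (u • a) = t.act g u • (t.op g * a) := by
  ext v
  simp [op]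

theorem op_mul_mulLeft (g : W) (u : K) :
    t.op g * LinearMap.mulLeft ℂ u = LinearMap.mulLeft ℂ (t.act g u) * t.op g := by
  ext v
  simp [op]

theorem diffOp_X_mul_smul (i : Fin n) (u : K) (a : Module.End ℂ K) :
    t.diffOp (X i) * (u • a) = u • (t.diffOp (X i) * a) + t.der i u • a := by
  ext v
  simp [diffOp_X, mul_comm]

theorem op_mul_diffOp_X (g : W) (i : Fin n) :
    t.op g * t.diffOp (X i) = ∑ j, t.dualMat g i j • (t.diffOp (X j) * t.op g) := by
  ext u
  simpa [diffOp_X, op] using t.act_der g i u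

theorem diffOp_mul_mulLeft (q : MvPolynomial (Fin n) ℂ) (j : Fin n) :
    t.diffOp q * LinearMap.mulLeft ℂ (t.x j) =
      t.x j • t.diffOp q + t.diffOp (pderiv j q) := by
  classical
  induction q using MvPolynomial.induction_on with
  | C z =>
    ext v
    have : t.diffOp (C z) = algebraMap ℂ _ z := t.diffOp.commutes z
    simp [this]
  | add p q hp hq =>
    rw [map_add, add_mul, hp, hq, map_add, map_add, smul_add]
    abel
  | mul_X p i ih =>
    have h1 : t.diffOp (X i) * LinearMap.mulLeft ℂ (t.x j) =
        LinearMap.mulLeft ℂ (t.x j) * t.diffOp (X i) + t.diffOp (pderiv j (X i)) := by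
      ext v
      rw [pderiv_X]
      rcases eq_or_ne i j with rfl | h
      · simp [diffOp_X, t.der_x, mul_comm, add_comm]
      · simp [diffOp_X, t.der_x, h, mul_comm]
    rw [map_mul, mul_assoc, h1, mul_add, ← mul_assoc, ih, Derivation.leibniz, map_add,
      smul_eq_mul, smul_eq_mul, map_mul, map_mul, add_mul, add_assoc]
    congr 1
    rw [add_comm, ← map_mul t.diffOp (X i), ← map_mul t.diffOp (pderiv j p), mul_comm (X i)]

/-- The operators `∑ u_{β,g} ∂^β g` with all `β` of degree smaller than `d`. -/
def orderLT (d : ℕ) : Submodule K (Module.End ℂ K) :=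
  Submodule.span K {a | ∃ β g, β.degree < d ∧ a = t.diffOp (monomial β 1) * t.op g}

theorem diffOp_mul_op_mem {d : ℕ} {β : Fin n →₀ ℕ} (hβ : β.degree < d) (g : W) :
    t.diffOp (monomial β 1) * t.op g ∈ t.orderLT d :=
  Submodule.subset_span ⟨β, g, hβ, rfl⟩

theorem orderLT_mono {d e : ℕ} (h : d ≤ e) : t.orderLT d ≤ t.orderLT e :=
  Submodule.span_mono fun _ ⟨β, g, hβ, ha⟩ => ⟨β, g, hβ.trans_le h, ha⟩

theorem monomial_single_add (i : Fin n) (β : Fin n →₀ ℕ) :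
    (monomial (Finsupp.single i 1 + β) 1 : MvPolynomial (Fin n) ℂ) = X i * monomial β 1 := by
  rw [X, monomial_mul, one_mul]

theorem degree_single_add (i : Fin n) (β : Fin n →₀ ℕ) :
    (Finsupp.single i 1 + β).degree = β.degree + 1 := by
  rw [map_add, Finsupp.degree_single, add_comm]

theorem diffOp_X_mul_mem {d : ℕ} {a : Module.End ℂ K} (ha : a ∈ t.orderLT d) (i : Fin n) :
    t.diffOp (X i) * a ∈ t.orderLT (d + 1) := by
  induction ha using Submodule.span_induction with
  | mem a h =>
    obtain ⟨β, g, hβ, rfl⟩ := h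
    rw [← mul_assoc, ← map_mul, ← monomial_single_add]
    exact t.diffOp_mul_op_mem (by rw [degree_single_add]; omega) g
  | zero => simp
  | add a b _ _ ha hb => rw [mul_add]; exact add_mem ha hb
  | smul u a h ih =>
    rw [diffOp_X_mul_smul]
    exact add_mem (Submodule.smul_mem _ _ ih)
      (Submodule.smul_mem _ _ (t.orderLT_mono (Nat.le_succ d) h))

theorem op_mul_mem {d : ℕ} {a : Module.End ℂ K} (ha : a ∈ t.orderLT d) (s : W) :
    t.op s * a ∈ t.orderLT d := by
  have key : ∀ (β : Fin n →₀ ℕ) (g : W),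
      t.op s * (t.diffOp (monomial β 1) * t.op g) ∈ t.orderLT (β.degree + 1) := by
    intro β g
    induction β using monomial_add_single_induction with
    | zero =>
      have h1 : t.diffOp (monomial 0 1) = 1 := map_one t.diffOp
      have := t.diffOp_mul_op_mem (β := 0) (d := (0 : Fin n →₀ ℕ).degree + 1) (by simp) (s * g)
      rw [h1, one_mul] at this
      rwa [h1, one_mul, op_mul]
    | add i β ih =>
      rw [monomial_single_add, map_mul, mul_assoc, ← mul_assoc (t.op s), op_mul_diffOp_X,
        Finset.sum_mul, degree_single_add]
      refine sum_mem fun j _ => ?_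
      rw [smul_mul_assoc, mul_assoc]
      exact Submodule.smul_of_tower_mem _ _ (t.diffOp_X_mul_mem ih j)
  induction ha using Submodule.span_induction with
  | mem a h =>
    obtain ⟨β, g, hβ, rfl⟩ := h
    exact t.orderLT_mono hβ (key β g)
  | zero => simp
  | add a b _ _ ha hb => rw [mul_add]; exact add_mem ha hb
  | smul u a h ih =>
    rw [op_smul]
    exact Submodule.smul_mem _ _ ih

theorem mul_op_mem {d : ℕ} {a : Module.End ℂ K} (ha : a ∈ t.orderLT d) (g : W) :
    a * t.op g ∈ t.orderLT d := by
  induction ha using Submodule.span_induction with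
  | mem a h =>
    obtain ⟨β, h, hβ, rfl⟩ := h
    rw [mul_assoc, op_mul]
    exact t.diffOp_mul_op_mem hβ _
  | zero => simp
  | add a b _ _ ha hb => rw [add_mul]; exact add_mem ha hb
  | smul u a h ih =>
    have : (u • a) * t.op g = u • (a * t.op g) := rfl
    rw [this]
    exact Submodule.smul_mem _ _ ih

theorem leadingTerm {T : MvPolynomial (Fin n) ℂ →ₐ[ℂ] Module.End ℂ K}
    (hT : ∀ i d, ∀ a ∈ t.orderLT d, (T (X i) - t.diffOp (X i)) * a ∈ t.orderLT d)
    (β : Fin n →₀ ℕ) :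
    T (monomial β 1) - t.diffOp (monomial β 1) ∈ t.orderLT β.degree := by
  induction β using monomial_add_single_induction with
  | zero =>
    have h1 : t.diffOp (monomial 0 1) = 1 := map_one t.diffOp
    have h2 : T (monomial 0 1) = 1 := map_one T
    rw [h1, h2, sub_self]
    exact zero_mem _
  | add i β ih =>
    have h1 : t.diffOp (monomial β 1) ∈ t.orderLT (β.degree + 1) := by
      simpa [op_one] using t.diffOp_mul_op_mem (Nat.lt_succ_self β.degree) 1
    have h2 : T (monomial β 1) ∈ t.orderLT (β.degree + 1) := by
      simpa using add_mem (t.orderLT_mono (Nat.le_succ _) ih) h1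
    rw [monomial_single_add, map_mul, map_mul, degree_single_add]
    have h3 : T (X i) * T (monomial β 1) - t.diffOp (X i) * t.diffOp (monomial β 1) =
        (T (X i) - t.diffOp (X i)) * T (monomial β 1) +
          t.diffOp (X i) * (T (monomial β 1) - t.diffOp (monomial β 1)) := by
      rw [sub_mul, mul_sub]
      abel
    rw [h3]
    exact add_mem (hT i _ _ h2) (t.diffOp_X_mul_mem ih i)

/-- The normally ordered differential operator with a given symbol. -/
def normalOrdered : MvPolynomial (Fin n) K →ₗ[K] Module.End ℂ K :=
  (basisMonomials (Fin n) K).constr K fun γ => t.diffOp (monomial γ 1)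

theorem normalOrdered_monomial (γ : Fin n →₀ ℕ) (u : K) :
    t.normalOrdered (monomial γ u) = u • t.diffOp (monomial γ 1) := by
  have h1 : monomial γ u = u • basisMonomials (Fin n) K γ := by
    simp [smul_monomial]
  rw [h1, map_smul, normalOrdered, Module.Basis.constr_basis]

theorem normalOrdered_mul_mulLeft (q : MvPolynomial (Fin n) K) (j : Fin n) :
    t.normalOrdered q * LinearMap.mulLeft ℂ (t.x j) =
      t.x j • t.normalOrdered q + t.normalOrdered (pderiv j q) := by
  induction q using MvPolynomial.induction_on' with
  | monomial γ u =>
    have h1 : (u • t.diffOp (monomial γ 1)) * LinearMap.mulLeft ℂ (t.x j) =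
      u • (t.diffOp (monomial γ 1) * LinearMap.mulLeft ℂ (t.x j)) := rfl
    have h2 : t.diffOp (monomial (γ - Finsupp.single j 1) (γ j : ℂ)) =
        (γ j : K) • t.diffOp (monomial (γ - Finsupp.single j 1) 1) := by
      have : (monomial (γ - Finsupp.single j 1) (γ j : ℂ)) =
        (γ j) • (monomial (γ - Finsupp.single j 1) (1 : ℂ)) := by
        rw [← map_nsmul]; simp
      rw [this, map_nsmul]
      ext v
      simp
    rw [pderiv_monomial, normalOrdered_monomial, normalOrdered_monomial, h1,
      diffOp_mul_mulLeft, pderiv_monomial, one_mul, h2, smul_add, smul_smul, smul_smul, smul_smul,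
      mul_comm u]
  | add p q hp hq =>
    rw [map_add, add_mul, hp, hq, map_add, map_add, smul_add]
    abel

variable [Fintype W]

theorem sum_normalOrdered_injective [IsDomain K] (q : W → MvPolynomial (Fin n) K)
    (hq : ∑ g, t.normalOrdered (q g) * t.op g = 0) : q = 0 := by
  refine twistedOperator_injective t.x t.normalOrdered (fun u => ?_) t.normalOrdered_mul_mulLeft
    t.op t.isUnit_op t.mat (fun g i => ?_) (fun g h hgh => ?_) q hq
  · have h1 : t.diffOp (monomial 0 1) = 1 := map_one t.diffOp
    rw [← monomial_zero', normalOrdered_monomial, h1]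
    rfl
  · rw [op_mul_mulLeft, act_x]
  · by_contra! h'
    exact hgh (t.faithful g h fun i => by rw [act_x, act_x, h'])

theorem exists_of_mem_orderLT {d : ℕ} {a : Module.End ℂ K} (ha : a ∈ t.orderLT d) :
    ∃ q : W → MvPolynomial (Fin n) K, (∀ g, q g ∈ degreeLT (Fin n) K d) ∧
      a = ∑ g, t.normalOrdered (q g) * t.op g := by
  classical
  induction ha using Submodule.span_induction with
  | mem a h =>
    obtain ⟨β, g, hβ, rfl⟩ := h
    refine ⟨Pi.single g (monomial β 1), fun h => ?_, ?_⟩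
    · rcases eq_or_ne h g with rfl | hne
      · simpa using monomial_mem_degreeLT hβ _
      · simp [hne]
    · rw [Finset.sum_eq_single g (fun h _ hne => by simp [hne]) (by simp), Pi.single_eq_same,
        normalOrdered_monomial, one_smul]
  | zero => exact ⟨0, fun g => by simp, by simp⟩
  | add a b _ _ ha hb =>
    obtain ⟨p, hp, rfl⟩ := ha
    obtain ⟨q, hq, rfl⟩ := hb
    refine ⟨p + q, fun g => add_mem (hp g) (hq g), ?_⟩
    simp [add_mul, Finset.sum_add_distrib]
  | smul u a h ih =>
    obtain ⟨p, hp, rfl⟩ := ih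
    refine ⟨u • p, fun g => Submodule.smul_mem _ _ (hp g), ?_⟩
    rw [Finset.smul_sum]
    refine Finset.sum_congr rfl fun g _ => ?_
    rw [Pi.smul_apply, map_smul]
    rfl

/-- Operators with the same leading terms as the monomials `∂^β` satisfy no relations. -/
theorem eq_zero_of_sum_eq_zero [IsDomain K] {T : MvPolynomial (Fin n) ℂ →ₐ[ℂ] Module.End ℂ K}
    (hT : ∀ i d, ∀ a ∈ t.orderLT d, (T (X i) - t.diffOp (X i)) * a ∈ t.orderLT d)
    (f : W × (Fin n →₀ ℕ) →₀ K)
    (hf : f.sum (fun p u => u • (T (monomial p.2 1) * t.op p.1)) = 0) : f = 0 := by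
  classical
  obtain ⟨d, hd⟩ : ∃ d, ∀ p ∈ f.support, p.2.degree < d :=
    ⟨f.support.sup (fun p => p.2.degree) + 1, fun p hp =>
      Nat.lt_succ_of_le (Finset.le_sup (f := fun p => p.2.degree) hp)⟩
  induction d with
  | zero =>
    rw [← Finsupp.support_eq_empty]
    exact Finset.eq_empty_of_forall_notMem fun p hp => absurd (hd p hp) (Nat.not_lt_zero _)
  | succ d ih =>
    refine ih fun p hp => ?_
    let q : W → MvPolynomial (Fin n) K := f.sum fun p u => Pi.single p.1 (monomial p.2 u)
    have hqc : ∀ g γ, (q g).coeff γ = f (g, γ) := by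
      intro g γ
      simp only [q, Finsupp.sum, Finset.sum_apply, coeff_sum]
      rw [Finset.sum_eq_single (g, γ)]
      · simp
      · rintro ⟨h, β⟩ _ hne
        rcases eq_or_ne g h with rfl | hgh
        · simp only [Pi.single_eq_same, coeff_monomial, ite_eq_right_iff]
          rintro rfl
          exact absurd rfl hne
        · simp [hgh]
      · intro h
        simp [Finsupp.notMem_support_iff.1 h]
    have hq : ∑ g, t.normalOrdered (q g) * t.op g =
        f.sum fun p u => u • (t.diffOp (monomial p.2 1) * t.op p.1) := by
      simp only [q, Finsupp.sum, Finset.sum_apply, map_sum, Finset.sum_mul]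
      rw [Finset.sum_comm]
      refine Finset.sum_congr rfl fun p _ => ?_
      rw [Finset.sum_eq_single p.1 (fun h _ hne => by simp [hne]) (by simp), Pi.single_eq_same,
        normalOrdered_monomial]
      rfl
    have hmem : (f.sum fun p u => u • (t.diffOp (monomial p.2 1) * t.op p.1)) ∈ t.orderLT d := by
      have h1 : (f.sum fun p u =>
          u • ((T (monomial p.2 1) - t.diffOp (monomial p.2 1)) * t.op p.1)) ∈ t.orderLT d :=
        sum_mem fun p hp => Submodule.smul_mem _ _ (t.mul_op_mem (t.orderLT_mono
          (Nat.lt_succ_iff.1 (hd p hp)) (t.leadingTerm hT p.2)) p.1)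
      simp only [sub_mul, smul_sub, Finsupp.sum_sub] at h1
      rw [hf, zero_sub] at h1
      exact neg_mem_iff.1 h1
    obtain ⟨q', hq', hE⟩ := t.exists_of_mem_orderLT hmem
    have heq : q - q' = 0 := by
      refine t.sum_normalOrdered_injective _ ?_
      simp only [Pi.sub_apply, map_sub, sub_mul, Finset.sum_sub_distrib]
      rw [hq, hE, sub_self]
    refine hq' p.1 p.2 ?_
    rw [← sub_eq_zero.1 heq, hqc]
    exact Finsupp.mem_support_iff.1 hp

end TwistedDerivations

instance {n : ℕ} (δP : PolyV n) : IsScalarTower ℂ (PolyV n) (LocReg δP) :=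
  IsScalarTower.of_algebraMap_eq fun _ => rfl

instance {n : ℕ} (δP : PolyV n) : IsLocalization.Away δP (LocReg δP) :=
  inferInstanceAs (IsLocalization.Away δP (Localization.Away δP))

instance (G : CRG V) : Finite G.W := G.finite

instance (G : CRG V) : Finite G.Refl :=
  inferInstanceAs (Finite {s : G.W // IsComplexReflection (s : V ≃ₗ[ℂ] V)})

theorem exists_stabIn_eq_bot (G : CRG V) : ∃ v, stabIn G v = ⊥ := by
  classical
  have := Fintype.ofFinite G.W
  let F : G.W → Submodule ℂ V := fun g => LinearMap.ker ((g : V ≃ₗ[ℂ] V).toLinearMap - LinearMap.id)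
  let s : Finset (Submodule ℂ V) := (Finset.univ.filter fun g : G.W => g ≠ 1).image F
  have hs : ⊤ ∉ s := by
    intro h
    obtain ⟨g, hg, hF⟩ := Finset.mem_image.1 h
    refine (Finset.mem_filter.1 hg).2 (Subtype.ext (LinearEquiv.ext fun v => ?_))
    have hv : v ∈ F g := hF ▸ Submodule.mem_top
    simpa [F, sub_eq_zero] using hv
  obtain ⟨v, hv⟩ := (Set.ne_univ_iff_exists_notMem _).1
    (Subspace.biUnion_ne_univ_of_top_notMem hs)
  refine ⟨v, (Subgroup.eq_bot_iff_forall _).2 fun g hg => ?_⟩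
  by_contra hne
  refine hv (Set.mem_iUnion₂.2 ⟨F g, Finset.mem_image.2 ⟨g, by simpa using hne, rfl⟩, ?_⟩)
  have hg' : (g : V ≃ₗ[ℂ] V) v = v := hg
  simp [F, hg']

theorem LocReg.isDomain {n : ℕ} {δP : PolyV n} (h : δP ≠ 0) : IsDomain (LocReg δP) :=
  IsLocalization.isDomain_localization (powers_le_nonZeroDivisors_of_noZeroDivisors h)

theorem LocReg.isUnit {n : ℕ} (δP : PolyV n) : IsUnit (algebraMap (PolyV n) (LocReg δP) δP) :=
  IsLocalization.Away.algebraMap_isUnit δP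

theorem LocReg.exists_mul_pow {n : ℕ} {δP : PolyV n} (u : LocReg δP) :
    ∃ (k : ℕ) (p : PolyV n), u * algebraMap (PolyV n) (LocReg δP) δP ^ k =
      algebraMap (PolyV n) (LocReg δP) p := by
  obtain ⟨k, p, h⟩ := IsLocalization.Away.surj δP u
  exact ⟨k, p, h⟩

theorem LocReg.derivation_ext {n : ℕ} {δP : PolyV n}
    {d₁ d₂ : Derivation ℂ (LocReg δP) (LocReg δP)}
    (h : ∀ i, d₁ (algebraMap (PolyV n) (LocReg δP) (MvPolynomial.X i)) =
      d₂ (algebraMap (PolyV n) (LocReg δP) (MvPolynomial.X i))) : d₁ = d₂ := by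
  have hp : ∀ p : PolyV n, (d₁ - d₂) (algebraMap (PolyV n) (LocReg δP) p) = 0 := by
    have : (d₁ - d₂).compAlgebraMap (PolyV n) = 0 :=
      MvPolynomial.derivation_ext fun i => by simpa [sub_eq_zero] using h i
    exact fun p => DFunLike.congr_fun this p
  rw [← sub_eq_zero]
  ext u
  obtain ⟨k, p, hu⟩ := exists_mul_pow u
  have h1 := congrArg (d₁ - d₂) hu
  rw [← map_pow, Derivation.leibniz, hp, hp, smul_zero, zero_add, map_pow, smul_eq_mul] at h1
  exact ((isUnit δP).pow k).mul_right_eq_zero.1 h1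

theorem polyAct_X {G : CRG V} {n : ℕ} (b : Basis (Fin n) ℂ V) (g : G.W) (i : Fin n) :
    polyAct b g (MvPolynomial.X i) =
      ∑ j, (b.coord i (((g⁻¹ : G.W) : V ≃ₗ[ℂ] V) (b j))) • MvPolynomial.X j := by
  simp [polyAct]

theorem polyAct_faithful {G : CRG V} {n : ℕ} (b : Basis (Fin n) ℂ V) {g h : G.W}
    (H : ∀ i, polyAct b g (MvPolynomial.X i) = polyAct b h (MvPolynomial.X i)) : g = h := by
  classical
  rw [← inv_inj]
  refine Subtype.ext (LinearEquiv.toLinearMap_injective (b.ext fun j => b.ext_elem fun i => ?_))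
  have := congrArg (MvPolynomial.coeff (Finsupp.single j 1)) (H i)
  simpa [polyAct_X, MvPolynomial.coeff_sum, MvPolynomial.coeff_X, Finsupp.single_left_inj]
    using this

theorem dualPoly_coord {n : ℕ} (b : Basis (Fin n) ℂ V) (i : Fin n) :
    dualPoly b (b.coord i) = MvPolynomial.X i := by
  classical
  simp [dualPoly, Finsupp.single_apply]

/-- The partial derivatives and the `W`-action on `ℂ[h^reg]` as crossed product data. -/
def LocReg.twistedDerivations {G : CRG V} {n : ℕ} (b : Basis (Fin n) ℂ V) (δP : PolyV n)
    (Dext : Fin n → Module.End ℂ (LocReg δP))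
    (hDalg : ∀ (i : Fin n) (f : PolyV n),
      Dext i (algebraMap (PolyV n) (LocReg δP) f)
        = algebraMap (PolyV n) (LocReg δP) (MvPolynomial.pderiv i f))
    (hLeib : ∀ (i : Fin n) (u v : LocReg δP),
      Dext i (u * v) = u * Dext i v + v * Dext i u)
    (ρ : G.W →* (LocReg δP ≃ₐ[ℂ] LocReg δP))
    (hρ : ∀ (g : G.W) (f : PolyV n),
      ρ g (algebraMap (PolyV n) (LocReg δP) f)
        = algebraMap (PolyV n) (LocReg δP) (polyAct b g f))
    (hinj : Function.Injective (algebraMap (PolyV n) (LocReg δP))) :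
    TwistedDerivations (LocReg δP) G.W n where
  x i := algebraMap (PolyV n) (LocReg δP) (MvPolynomial.X i)
  der i := Derivation.mk' (Dext i) (hLeib i)
  der_comm i j u := by
    have h : ⁅Derivation.mk' (Dext i) (hLeib i), Derivation.mk' (Dext j) (hLeib j)⁆ = 0 :=
      derivation_ext fun k => by
        classical
        simp [Derivation.commutator_apply, hDalg, MvPolynomial.pderiv_X, Pi.single_apply,
          apply_ite]
    have := DFunLike.congr_fun h u
    rwa [Derivation.commutator_apply, Derivation.zero_apply, sub_eq_zero] at this
  der_x i j := by
    classical
    rcases eq_or_ne i j with rfl | h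
    · simp [hDalg]
    · simp [hDalg, MvPolynomial.pderiv_X_of_ne h.symm, h]
  act := ρ
  mat g i j := b.coord i (((g⁻¹ : G.W) : V ≃ₗ[ℂ] V) (b j))
  act_x g i := by
    rw [hρ, polyAct_X, map_sum]
    refine Finset.sum_congr rfl fun j _ => ?_
    exact map_smul (IsScalarTower.toAlgHom ℂ (PolyV n) (LocReg δP)) _ _
  dualMat g i j := b.coord j ((g : V ≃ₗ[ℂ] V) (b i))
  act_der g i u := by
    classical
    let d₁ : Derivation ℂ (LocReg δP) (LocReg δP) :=
      Derivation.mk' ((ρ g).toLinearMap ∘ₗ Dext i ∘ₗ (ρ g⁻¹).toLinearMap) fun u v => by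
        simp [hLeib]
    let d₂ : Derivation ℂ (LocReg δP) (LocReg δP) :=
      Derivation.mk' (∑ j, b.coord j ((g : V ≃ₗ[ℂ] V) (b i)) • Dext j) fun u v => by
        simp [hLeib, Finset.mul_sum, Finset.sum_add_distrib]
    have hd : d₁ = d₂ := derivation_ext fun k => by
      have h₁ : MvPolynomial.pderiv i (polyAct b g⁻¹ (MvPolynomial.X k)) =
          algebraMap ℂ (PolyV n) (b.coord k ((g : V ≃ₗ[ℂ] V) (b i))) := by
        simp [polyAct_X, MvPolynomial.pderiv_X, Pi.single_apply, MvPolynomial.smul_eq_C_mul]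
      have h₂ : ∀ j, Dext j (algebraMap (PolyV n) (LocReg δP) (MvPolynomial.X k)) =
          if j = k then 1 else 0 := fun j => by
        rcases eq_or_ne j k with rfl | h
        · simp [hDalg]
        · simp [hDalg, MvPolynomial.pderiv_X_of_ne h.symm, h]
      have h₃ : d₁ (algebraMap (PolyV n) (LocReg δP) (MvPolynomial.X k)) =
          algebraMap ℂ (LocReg δP) (b.coord k ((g : V ≃ₗ[ℂ] V) (b i))) := by
        change ρ g (Dext i (ρ g⁻¹ _)) = _
        rw [hρ, hDalg, h₁, ← IsScalarTower.algebraMap_apply, AlgEquiv.commutes]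
      rw [h₃, Algebra.algebraMap_eq_smul_one]
      simp [d₂, h₂]
    have h := DFunLike.congr_fun hd (ρ g u)
    have hu : ρ g⁻¹ (ρ g u) = u := by
      rw [← AlgEquiv.mul_apply, ← map_mul, inv_mul_cancel, map_one, AlgEquiv.one_apply]
    simpa [d₁, d₂, hu] using h
  faithful g h H := polyAct_faithful b fun i => hinj (by rw [← hρ, ← hρ, H i])

theorem dualPoly_eq_sum {n : ℕ} (b : Basis (Fin n) ℂ V) (a : Module.Dual ℂ V) :
    a = ∑ i, a (b i) • b.coord i := by
  refine b.ext fun j => ?_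
  simp

namespace RCA

variable {G : CRG V} {D : ReflData G} {c : G.Refl → ℂ} (R : RCA G D c)

theorem adjoin_generators :
    Algebra.adjoin ℂ (Set.range R.x ∪ Set.range R.y ∪ Set.range R.w) = ⊤ := by
  have := Fintype.ofFinite G.Refl
  set B := Algebra.adjoin ℂ (Set.range R.x ∪ Set.range R.y ∪ Set.range R.w) with hB
  let xB : Module.Dual ℂ V →ₗ[ℂ] B :=
    { toFun := fun a => ⟨R.x a, Algebra.subset_adjoin (Or.inl (Or.inl ⟨a, rfl⟩))⟩
      map_add' := fun _ _ => Subtype.ext (map_add R.x _ _)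
      map_smul' := fun _ _ => Subtype.ext (map_smul R.x _ _) }
  let yB : V →ₗ[ℂ] B :=
    { toFun := fun v => ⟨R.y v, Algebra.subset_adjoin (Or.inl (Or.inr ⟨v, rfl⟩))⟩
      map_add' := fun _ _ => Subtype.ext (map_add R.y _ _)
      map_smul' := fun _ _ => Subtype.ext (map_smul R.y _ _) }
  let wB : G.W →* B :=
    { toFun := fun g => ⟨R.w g, Algebra.subset_adjoin (Or.inr ⟨g, rfl⟩)⟩
      map_one' := Subtype.ext (map_one R.w)
      map_mul' := fun _ _ => Subtype.ext (map_mul R.w _ _) }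
  obtain ⟨φ, ⟨hx, hy, hw⟩, -⟩ := R.universal B xB yB wB
    (fun _ _ => Subtype.ext (R.comm_x _ _)) (fun _ _ => Subtype.ext (R.comm_y _ _))
    (fun _ _ => Subtype.ext (R.w_x _ _)) (fun _ _ => Subtype.ext (R.w_y _ _))
    (fun v a => Subtype.ext (by
      have h := R.rel v a
      rw [finsum_eq_sum_of_fintype] at h ⊢
      simpa [xB, yB, wB] using h))
  obtain ⟨ψ, -, hψ⟩ := R.universal R.H R.x R.y R.w R.comm_x R.comm_y R.w_x R.w_y R.rel
  have hid : B.val.comp φ = AlgHom.id ℂ R.H :=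
    (hψ _ ⟨fun a => by simp [hx, xB], fun v => by simp [hy, yB], fun g => by simp [hw, wB]⟩).trans
      (hψ _ ⟨fun _ => rfl, fun _ => rfl, fun _ => rfl⟩).symm
  refine eq_top_iff.2 fun h _ => ?_
  rw [← AlgHom.id_apply (R := ℂ) h, ← hid]
  exact (φ h).2

theorem induction {P : R.H → Prop} (x : ∀ a, P (R.x a)) (y : ∀ v, P (R.y v))
    (w : ∀ g, P (R.w g)) (algebraMap : ∀ z, P (algebraMap ℂ R.H z))
    (add : ∀ h k, P h → P k → P (h + k)) (mul : ∀ h k, P h → P k → P (h * k)) (h : R.H) : P h := by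
  have hh : h ∈ Algebra.adjoin ℂ (Set.range R.x ∪ Set.range R.y ∪ Set.range R.w) :=
    R.adjoin_generators ▸ Algebra.mem_top
  induction hh using Algebra.adjoin_induction with
  | mem h hh =>
    obtain (⟨a, rfl⟩ | ⟨v, rfl⟩) | ⟨g, rfl⟩ := hh
    exacts [x a, y v, w g]
  | algebraMap z => exact algebraMap z
  | add h k _ _ hh hk => exact add h k hh hk
  | mul h k _ _ hh hk => exact mul h k hh hk

variable {n : ℕ} (b : Basis (Fin n) ℂ V)

theorem exists_polyX : ∃ φ : PolyV n →ₐ[ℂ] R.H, ∀ i, φ (MvPolynomial.X i) = R.x (b.coord i) :=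
  MvPolynomial.exists_algHom_of_commute _ fun _ _ => R.comm_x _ _

theorem exists_polyY : ∃ φ : PolyV n →ₐ[ℂ] R.H, ∀ i, φ (MvPolynomial.X i) = R.y (b i) :=
  MvPolynomial.exists_algHom_of_commute _ fun _ _ => R.comm_y _ _

/-- The inclusion `ℂ[h] → H_c`. -/
def polyX : PolyV n →ₐ[ℂ] R.H := (R.exists_polyX b).choose

/-- The inclusion `ℂ[h*] → H_c`. -/
def polyY : PolyV n →ₐ[ℂ] R.H := (R.exists_polyY b).choose

theorem polyX_X (i : Fin n) : R.polyX b (MvPolynomial.X i) = R.x (b.coord i) :=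
  (R.exists_polyX b).choose_spec i

theorem polyY_X (i : Fin n) : R.polyY b (MvPolynomial.X i) = R.y (b i) :=
  (R.exists_polyY b).choose_spec i

theorem polyX_dualPoly (a : Module.Dual ℂ V) : R.polyX b (dualPoly b a) = R.x a := by
  conv_rhs => rw [dualPoly_eq_sum b a]
  simp only [dualPoly, polyX_X, ← MvPolynomial.smul_eq_C_mul, map_sum, map_smul]

theorem exists_polyY_eq (v : V) : ∃ q, R.polyY b q = R.y v := by
  refine ⟨∑ i, b.repr v i • MvPolynomial.X i, ?_⟩
  conv_rhs => rw [← b.sum_repr v]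
  simp only [map_sum, map_smul, polyY_X]

theorem exists_w_mul_polyX (g : G.W) (p : PolyV n) :
    ∃ p', R.w g * R.polyX b p = R.polyX b p' * R.w g := by
  induction p using MvPolynomial.induction_on with
  | C z => exact ⟨MvPolynomial.C z, by
      rw [← MvPolynomial.algebraMap_eq, AlgHom.commutes, Algebra.commutes]⟩
  | add p q hp hq =>
    obtain ⟨p', hp⟩ := hp
    obtain ⟨q', hq⟩ := hq
    exact ⟨p' + q', by rw [map_add, map_add, mul_add, add_mul, hp, hq]⟩
  | mul_X p i hp =>
    obtain ⟨p', hp⟩ := hp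
    refine ⟨p' * dualPoly b (b.coord i ∘ₗ (((g⁻¹ : G.W) : V ≃ₗ[ℂ] V) : V →ₗ[ℂ] V)), ?_⟩
    rw [map_mul, map_mul, polyX_dualPoly, polyX_X, ← mul_assoc, hp, mul_assoc, R.w_x, mul_assoc]

theorem exists_w_mul_polyY (g : G.W) (p : PolyV n) :
    ∃ p', R.w g * R.polyY b p = R.polyY b p' * R.w g := by
  induction p using MvPolynomial.induction_on with
  | C z => exact ⟨MvPolynomial.C z, by
      rw [← MvPolynomial.algebraMap_eq, AlgHom.commutes, Algebra.commutes]⟩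
  | add p q hp hq =>
    obtain ⟨p', hp⟩ := hp
    obtain ⟨q', hq⟩ := hq
    exact ⟨p' + q', by rw [map_add, map_add, mul_add, add_mul, hp, hq]⟩
  | mul_X p i hp =>
    obtain ⟨p', hp⟩ := hp
    obtain ⟨q, hq⟩ := R.exists_polyY_eq b ((g : V ≃ₗ[ℂ] V) (b i))
    refine ⟨p' * q, ?_⟩
    rw [map_mul, map_mul, hq, polyY_X, ← mul_assoc, hp, mul_assoc, R.w_y, mul_assoc]

/-- The image of `ℂ[h]#W` in `H_c`. -/
def polyW : Submodule ℂ R.H := Submodule.span ℂ {h | ∃ p g, h = R.polyX b p * R.w g}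

theorem polyX_mul_w_mem (p : PolyV n) (g : G.W) : R.polyX b p * R.w g ∈ R.polyW b :=
  Submodule.subset_span ⟨p, g, rfl⟩

theorem polyX_mul_mem (p : PolyV n) {h : R.H} (hh : h ∈ R.polyW b) :
    R.polyX b p * h ∈ R.polyW b := by
  refine (Submodule.span_le (p := (R.polyW b).comap (LinearMap.mulLeft ℂ (R.polyX b p)))).2 ?_ hh
  rintro _ ⟨q, g, rfl⟩
  rw [Submodule.comap_coe, Set.mem_preimage, LinearMap.mulLeft_apply, ← mul_assoc, ← map_mul]
  exact R.polyX_mul_w_mem b _ g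

theorem mul_polyX_mem (p : PolyV n) {h : R.H} (hh : h ∈ R.polyW b) :
    h * R.polyX b p ∈ R.polyW b := by
  refine (Submodule.span_le (p := (R.polyW b).comap (LinearMap.mulRight ℂ (R.polyX b p)))).2 ?_ hh
  rintro _ ⟨q, g, rfl⟩
  obtain ⟨p', hp⟩ := R.exists_w_mul_polyX b g p
  rw [Submodule.comap_coe, Set.mem_preimage, LinearMap.mulRight_apply, mul_assoc, hp, ← mul_assoc,
    ← map_mul]
  exact R.polyX_mul_w_mem b _ g

theorem commutator_mem (v : V) (p : PolyV n) :
    R.y v * R.polyX b p - R.polyX b p * R.y v ∈ R.polyW b := by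
  have := Fintype.ofFinite G.Refl
  have hw (g : G.W) : R.w g ∈ R.polyW b := by simpa using R.polyX_mul_w_mem b 1 g
  induction p using MvPolynomial.induction_on with
  | C z =>
    rw [← MvPolynomial.algebraMap_eq, AlgHom.commutes, Algebra.commutes, sub_self]
    exact zero_mem _
  | add p q hp hq =>
    rw [map_add, mul_add, add_mul, add_sub_add_comm]
    exact add_mem hp hq
  | mul_X p i hp =>
    have h1 : R.y v * R.x (b.coord i) - R.x (b.coord i) * R.y v ∈ R.polyW b := by
      rw [R.rel, finsum_eq_sum_of_fintype, Algebra.algebraMap_eq_smul_one, ← map_one R.w]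
      exact sub_mem (Submodule.smul_mem _ _ (hw 1))
        (sum_mem fun s _ => Submodule.smul_mem _ _ (hw _))
    have h2 : R.y v * R.polyX b (p * MvPolynomial.X i) - R.polyX b (p * MvPolynomial.X i) * R.y v =
        (R.y v * R.polyX b p - R.polyX b p * R.y v) * R.polyX b (MvPolynomial.X i) +
        R.polyX b p * (R.y v * R.x (b.coord i) - R.x (b.coord i) * R.y v) := by
      rw [map_mul, polyX_X]
      noncomm_ring
    rw [h2]
    exact add_mem (R.mul_polyX_mem b _ hp) (R.polyX_mul_mem b _ h1)

theorem mem_span_polyX_mul_polyY_mul_w (h : R.H) :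
    h ∈ Submodule.span ℂ {h | ∃ p q g, h = R.polyX b p * (R.polyY b q * R.w g)} := by
  set M := Submodule.span ℂ {h | ∃ p q g, h = R.polyX b p * (R.polyY b q * R.w g)} with hM
  have hmem p q g : R.polyX b p * (R.polyY b q * R.w g) ∈ M := Submodule.subset_span ⟨p, q, g, rfl⟩
  have hle {N : Submodule ℂ R.H} (k : R.H)
      (hk : ∀ p q g, k * (R.polyX b p * (R.polyY b q * R.w g)) ∈ N) : ∀ m ∈ M, k * m ∈ N := by
    refine fun m hm => (Submodule.span_le (p := N.comap (LinearMap.mulLeft ℂ k))).2 ?_ hm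
    rintro _ ⟨p, q, g, rfl⟩
    exact hk p q g
  have hW (k : R.H) (hk : k ∈ R.polyW b) (q : PolyV n) (g : G.W) :
      k * (R.polyY b q * R.w g) ∈ M := by
    refine (Submodule.span_le
      (p := M.comap (LinearMap.mulRight ℂ (R.polyY b q * R.w g)))).2 ?_ hk
    rintro _ ⟨p, g', rfl⟩
    obtain ⟨q', hq⟩ := R.exists_w_mul_polyY b g' q
    have : R.polyX b p * R.w g' * (R.polyY b q * R.w g) =
        R.polyX b p * (R.polyY b q' * R.w (g' * g)) := by
      rw [mul_assoc, ← mul_assoc (R.w g'), hq, mul_assoc, map_mul]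
    rw [Submodule.comap_coe, Set.mem_preimage, LinearMap.mulRight_apply, this]
    exact hmem _ _ _
  suffices h' : ∀ m ∈ M, h * m ∈ M by
    simpa using h' 1 (by simpa using hmem 1 1 1)
  induction h using R.induction with
  | x a =>
    refine hle _ fun p q g => ?_
    rw [← R.polyX_dualPoly b, ← mul_assoc, ← map_mul]
    exact hmem _ _ _
  | y v =>
    refine hle _ fun p q g => ?_
    obtain ⟨r, hr⟩ := R.exists_polyY_eq b v
    have : R.y v * (R.polyX b p * (R.polyY b q * R.w g)) =
        (R.y v * R.polyX b p - R.polyX b p * R.y v) * (R.polyY b q * R.w g) +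
        R.polyX b p * (R.polyY b (r * q) * R.w g) := by
      rw [map_mul, hr]
      noncomm_ring
    rw [this]
    exact add_mem (hW _ (R.commutator_mem b v p) q g) (hmem _ _ _)
  | w g =>
    refine hle _ fun p q g' => ?_
    obtain ⟨p', hp⟩ := R.exists_w_mul_polyX b g p
    rw [← mul_assoc, hp]
    exact hW _ (R.polyX_mul_w_mem b p' g) q g'
  | algebraMap z =>
    intro m hm
    rw [← Algebra.smul_def]
    exact Submodule.smul_mem _ _ hm
  | add h k hh hk =>
    intro m hm
    rw [add_mul]
    exact add_mem (hh m hm) (hk m hm)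
  | mul h k hh hk =>
    intro m hm
    rw [mul_assoc]
    exact hh _ (hk m hm)

/-- The elements `x^α y^β w` span `H_c`. -/
theorem exists_eq_sum (h : R.H) : ∃ f : G.W × (Fin n →₀ ℕ) →₀ PolyV n,
    h = f.sum fun p u => R.polyX b u * (R.polyY b (MvPolynomial.monomial p.2 1) * R.w p.1) := by
  classical
  let F : (G.W × (Fin n →₀ ℕ) →₀ PolyV n) →ₗ[ℂ] R.H :=
    Finsupp.lsum ℂ fun p => LinearMap.mulRight ℂ
      (R.polyY b (MvPolynomial.monomial p.2 1) * R.w p.1) ∘ₗ (R.polyX b).toLinearMap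
  suffices h ∈ LinearMap.range F by
    obtain ⟨f, rfl⟩ := this
    exact ⟨f, rfl⟩
  refine Submodule.span_le.2 ?_ (R.mem_span_polyX_mul_polyY_mul_w b h)
  rintro _ ⟨p, q, g, rfl⟩
  induction q using MvPolynomial.induction_on' with
  | monomial β z =>
    refine ⟨Finsupp.single (g, β) (z • p), ?_⟩
    have : MvPolynomial.monomial β z = z • MvPolynomial.monomial β (1 : ℂ) := by
      simp [MvPolynomial.smul_monomial]
    simp [F, this, mul_assoc]
  | add q r hq hr =>
    rw [map_add, add_mul, mul_add]
    exact add_mem hq hr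

end RCA

theorem mul_pow_succ_of_commutator {A : Type*} [Ring A] {y d e : A} (h : y * d = d * y + e)
    (he : e * d = d * e) (k : ℕ) : y * d ^ (k + 1) = d ^ k * (d * y + (k + 1) • e) := by
  induction k with
  | zero => simpa using h
  | succ k ih =>
    have : (d * y + (k + 1) • e) * d = d * (d * y + (k + 2) • e) := by
      rw [add_mul, mul_assoc, h, smul_mul_assoc, he, mul_add, mul_add, mul_smul_comm,
        add_assoc, ← succ_nsmul']
    rw [pow_succ, ← mul_assoc, ih, mul_assoc, this, pow_succ d k, mul_assoc]

/-- If `δ` satisfies the right Ore condition in `H`, then the right fractions `Θ(h) Θ(δ)⁻ᵏ` form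
a subalgebra. -/
theorem exists_mul_pow_eq_of_mem_adjoin {H A : Type*} [Ring H] [Algebra ℂ H] [Ring A] [Algebra ℂ A]
    (Θ : H →ₐ[ℂ] A) (δ : H) (ore : ∀ h k, ∃ m h', h * δ ^ m = δ ^ k * h') {s : Set A}
    (hs : ∀ a ∈ s, ∃ h k, a * Θ δ ^ k = Θ h) {a : A} (ha : a ∈ Algebra.adjoin ℂ s) :
    ∃ h k, a * Θ δ ^ k = Θ h := by
  induction ha using Algebra.adjoin_induction with
  | mem a ha => exact hs a ha
  | algebraMap z => exact ⟨algebraMap ℂ H z, 0, by simp⟩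
  | add a b _ _ ha hb =>
    obtain ⟨h, k, ha⟩ := ha
    obtain ⟨h', l, hb⟩ := hb
    refine ⟨h * δ ^ l + h' * δ ^ k, k + l, ?_⟩
    rw [add_mul, pow_add, ← mul_assoc, ha, ← pow_add, add_comm k, pow_add, ← mul_assoc, hb]
    simp
  | mul a b _ _ ha hb =>
    obtain ⟨h, k, ha⟩ := ha
    obtain ⟨h', l, hb⟩ := hb
    obtain ⟨m, h'', hm⟩ := ore h' k
    refine ⟨h * h'', l + m, ?_⟩
    have := congrArg Θ hm
    simp only [map_mul, map_pow] at this
    rw [pow_add, mul_assoc a, ← mul_assoc b, hb, this, ← mul_assoc, ha, map_mul]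

namespace RCA

variable {G : CRG V} {D : ReflData G} {c : G.Refl → ℂ} (R : RCA G D c)

theorem ore {δ : R.H} (hx : ∀ a, R.x a * δ = δ * R.x a) (hw : ∀ g, R.w g * δ = δ * R.w g)
    (hy : ∀ v, ∃ e, R.y v * δ = δ * R.y v + e ∧ e * δ = δ * e) (h : R.H) (k : ℕ) :
    ∃ m h', h * δ ^ m = δ ^ k * h' := by
  induction h using R.induction generalizing k with
  | x a => exact ⟨k, R.x a, ((show Commute (R.x a) δ from hx a).pow_right k).eq⟩
  | y v =>
    obtain ⟨e, he, hc⟩ := hy v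
    exact ⟨k + 1, _, mul_pow_succ_of_commutator he hc k⟩
  | w g => exact ⟨k, R.w g, ((show Commute (R.w g) δ from hw g).pow_right k).eq⟩
  | algebraMap z => exact ⟨k, algebraMap ℂ R.H z, Algebra.commutes _ _⟩
  | add h h' ih ih' =>
    obtain ⟨m, p, hm⟩ := ih k
    obtain ⟨m', p', hm'⟩ := ih' k
    refine ⟨m + m', p * δ ^ m' + p' * δ ^ m, ?_⟩
    rw [add_mul, pow_add, ← mul_assoc, hm, ← pow_add, add_comm m, pow_add, ← mul_assoc, hm',
      mul_add, mul_assoc, mul_assoc]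
  | mul h h' ih ih' =>
    obtain ⟨m, p, hm⟩ := ih k
    obtain ⟨m', p', hm'⟩ := ih' m
    exact ⟨m', p * p', by rw [mul_assoc, hm', ← mul_assoc, hm, mul_assoc]⟩

variable {n : ℕ} (b : Basis (Fin n) ℂ V)

theorem map_polyX {δP : PolyV n} (Θ : R.H →ₐ[ℂ] Module.End ℂ (LocReg δP))
    (hΘx : ∀ a : Module.Dual ℂ V, Θ (R.x a) = LinearMap.mulLeft ℂ
      (algebraMap (PolyV n) (LocReg δP) (dualPoly b a))) (p : PolyV n) :
    Θ (R.polyX b p) = LinearMap.mulLeft ℂ (algebraMap (PolyV n) (LocReg δP) p) := by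
  have : Θ.comp (R.polyX b) =
      (Algebra.lmul ℂ (LocReg δP)).comp (IsScalarTower.toAlgHom ℂ (PolyV n) (LocReg δP)) :=
    MvPolynomial.algHom_ext fun i => by
      rw [AlgHom.comp_apply, polyX_X, hΘx, dualPoly_coord]
      rfl
  exact DFunLike.congr_fun this p

/-- A homomorphism given on generators by `x ↦ x`, `w ↦ w`, `y ↦ ∂_y +` (terms of order `0`)
is injective. -/
theorem injective_of_leadingTerm {δP : PolyV n} (hδ : δP ≠ 0)
    (t : TwistedDerivations (LocReg δP) G.W n) (Θ : R.H →ₐ[ℂ] Module.End ℂ (LocReg δP))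
    (hΘx : ∀ a : Module.Dual ℂ V, Θ (R.x a) = LinearMap.mulLeft ℂ
      (algebraMap (PolyV n) (LocReg δP) (dualPoly b a)))
    (hΘw : ∀ g, Θ (R.w g) = t.op g)
    (hΘy : ∀ i d, ∀ a ∈ t.orderLT d,
      (Θ (R.y (b i)) - (t.der i).toLinearMap) * a ∈ t.orderLT d) :
    Function.Injective Θ := by
  have := Fintype.ofFinite G.W
  have := LocReg.isDomain hδ
  have hinj : Function.Injective (algebraMap (PolyV n) (LocReg δP)) :=
    IsLocalization.injective _ (powers_le_nonZeroDivisors_of_noZeroDivisors hδ)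
  refine (injective_iff_map_eq_zero Θ).2 fun h hh => ?_
  obtain ⟨f, rfl⟩ := R.exists_eq_sum b h
  have hf : f.mapRange (algebraMap (PolyV n) (LocReg δP)) (map_zero _) = 0 := by
    refine t.eq_zero_of_sum_eq_zero (T := Θ.comp (R.polyY b)) (fun i d a ha => ?_) _ ?_
    · rw [AlgHom.comp_apply, polyY_X, t.diffOp_X]
      exact hΘy i d a ha
    · refine (Finsupp.sum_mapRange_index fun p =>
        zero_smul (LocReg δP) (Θ.comp (R.polyY b) (MvPolynomial.monomial p.2 1) * t.op p.1)).trans ?_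
      rw [← hh, map_finsuppSum]
      refine Finsupp.sum_congr fun p _ => ?_
      rw [map_mul, map_mul, hΘw, R.map_polyX b Θ hΘx]
      rfl
  have hf0 : f = 0 := Finsupp.mapRange_injective _ (map_zero _) hinj
    (by rw [hf, Finsupp.mapRange_zero])
  rw [hf0, Finsupp.sum_zero_index]

end RCA

/-- **The localization lemma for the Dunkl embedding** (GGOR).
Let `h^reg = {v ∈ h | W_v = 1}` and let `δ ∈ ℂ[h]^W` have zero set
`h ∖ h^reg`.  The Dunkl homomorphism `Θ : H_c → D(h^reg)#W`, given on
generators by `x ↦ x`, `w ↦ w`,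
`y ↦ ∂_y + Σ_{s∈S} (2c(s)⟨α_s,y⟩/((1−λ_s)α_s))(s−1)`, induces an isomorphism
`H_c[δ⁻¹] ≅ D(h^reg)#W`.

Here `D(h^reg)#W` is realized concretely as the subalgebra of
`End_ℂ(ℂ[h][δ⁻¹])` generated by the multiplication operators, the (unique)
extensions `∂_i` of the partial derivatives, and the operators giving the
`W`-action; "`Θ` induces an isomorphism after inverting `δ`" is expressed by:
`Θ` is injective, takes values in `D(h^reg)#W`, `Θ(δ)` is invertible there,
and every element of `D(h^reg)#W` is a right fraction `Θ(h)·Θ(δ)^{−k}`. -/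
theorem dunkl_localization
    {G : CRG V} {D : ReflData G} {c : G.Refl → ℂ}
    (hc : IsConjInvariant c) (R : RCA G D c)
    {n : ℕ} (b : Basis (Fin n) ℂ V)
    -- δ : a W-invariant polynomial with zero set `h ∖ h^reg`
    (δP : PolyV n)
    (hδW : ∀ g : G.W, polyAct b g δP = δP)
    (hδzero : ∀ v : V,
      (MvPolynomial.eval (fun i => b.repr v i) δP = 0 ↔ stabIn G v ≠ ⊥))
    -- the (unique) extensions of the partial derivatives to `ℂ[h][δ⁻¹]`
    (Dext : Fin n → Module.End ℂ (LocReg δP))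
    (hDalg : ∀ (i : Fin n) (f : PolyV n),
      Dext i (algebraMap (PolyV n) (LocReg δP) f)
        = algebraMap (PolyV n) (LocReg δP) (MvPolynomial.pderiv i f))
    (hLeib : ∀ (i : Fin n) (u v : LocReg δP),
      Dext i (u * v) = u * Dext i v + v * Dext i u)
    -- the (unique) extension of the W-action to `ℂ[h][δ⁻¹]`
    (ρ : G.W →* (LocReg δP ≃ₐ[ℂ] LocReg δP))
    (hρ : ∀ (g : G.W) (f : PolyV n),
      ρ g (algebraMap (PolyV n) (LocReg δP) f)
        = algebraMap (PolyV n) (LocReg δP) (polyAct b g f))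
    -- the linear forms `α_s` are invertible on `h^reg`
    (hαunit : ∀ s : G.Refl,
      IsUnit (algebraMap (PolyV n) (LocReg δP) (dualPoly b (D.α s))))
    -- the Dunkl homomorphism
    (Θ : R.H →ₐ[ℂ] Module.End ℂ (LocReg δP))
    (hΘx : ∀ a : Module.Dual ℂ V,
      Θ (R.x a) = LinearMap.mulLeft ℂ
        (algebraMap (PolyV n) (LocReg δP) (dualPoly b a)))
    (hΘw : ∀ g : G.W, Θ (R.w g) = (ρ g).toLinearMap)
    (hΘy : ∀ v : V,
      Θ (R.y v) = (∑ i, (b.repr v i) • Dext i) +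
        ∑ᶠ s : G.Refl, ((2 * c s * D.α s v) / (1 - D.lam s)) •
          (LinearMap.mulLeft ℂ
              (Ring.inverse
                (algebraMap (PolyV n) (LocReg δP) (dualPoly b (D.α s)))) *
            ((ρ s.1).toLinearMap - 1)))
    -- the element `δ ∈ ℂ[h]^W ⊂ H_c`
    (δH : R.H)
    (hδH : δH ∈ Algebra.adjoin ℂ (Set.range R.x))
    (hδHW : ∀ g : G.W, R.w g * δH = δH * R.w g)
    (hδHΘ : Θ δH
      = LinearMap.mulLeft ℂ (algebraMap (PolyV n) (LocReg δP) δP)) :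
    -- `D(h^reg)#W`:
    (fun DW : Subalgebra ℂ (Module.End ℂ (LocReg δP)) =>
      -- `Θ` extends to an isomorphism `H_c[δ⁻¹] ≅ D(h^reg)#W`:
      Function.Injective Θ ∧
      (∀ h : R.H, Θ h ∈ DW) ∧
      IsUnit (Θ δH) ∧ Ring.inverse (Θ δH) ∈ DW ∧
      ∀ a ∈ DW, ∃ (h : R.H) (k : ℕ), a * (Θ δH) ^ k = Θ h)
    (Algebra.adjoin ℂ
      (Set.range (fun f : LocReg δP => LinearMap.mulLeft ℂ f) ∪
        Set.range Dext ∪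
        Set.range (fun g : G.W => (ρ g).toLinearMap))) := by
  have := Fintype.ofFinite G.Refl
  have hδ : δP ≠ 0 := by
    obtain ⟨v, hv⟩ := exists_stabIn_eq_bot G
    rintro rfl
    exact (hδzero v).1 (map_zero _) hv
  have hinj : Function.Injective (algebraMap (PolyV n) (LocReg δP)) :=
    IsLocalization.injective _ (powers_le_nonZeroDivisors_of_noZeroDivisors hδ)
  let t := LocReg.twistedDerivations b δP Dext hDalg hLeib ρ hρ hinj
  let A : V → Module.End ℂ (LocReg δP) := fun v =>
    ∑ s : G.Refl, ((2 * c s * D.α s v) / (1 - D.lam s)) •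
      (LinearMap.mulLeft ℂ
        (Ring.inverse (algebraMap (PolyV n) (LocReg δP) (dualPoly b (D.α s)))) *
          ((ρ s.1).toLinearMap - 1))
  have hΘy' : ∀ v, Θ (R.y v) = (∑ i, (b.repr v i) • Dext i) + A v := fun v => by
    rw [hΘy, finsum_eq_sum_of_fintype]
  have hΘb : ∀ i, Θ (R.y (b i)) = Dext i + A (b i) := fun i => by
    rw [hΘy', Finset.sum_eq_single i (fun j _ h => by simp [h.symm]) (by simp)]
    simp
  set δK := algebraMap (PolyV n) (LocReg δP) δP with hδK
  have hΘinj : Function.Injective Θ := by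
    refine R.injective_of_leadingTerm b hδ t Θ hΘx hΘw fun i d a ha => ?_
    have : Θ (R.y (b i)) - (t.der i).toLinearMap = A (b i) :=
      sub_eq_iff_eq_add'.2 (hΘb i)
    rw [this, Finset.sum_mul]
    refine sum_mem fun s _ => ?_
    rw [smul_mul_assoc, mul_assoc (LinearMap.mulLeft ℂ _), ← algebraMap_smul (LocReg δP), sub_mul, one_mul]
    exact Submodule.smul_mem _ _ (Submodule.smul_mem _ (Ring.inverse _)
      (sub_mem (t.op_mul_mem ha s.1) ha))
  have hρδ : ∀ g, ρ g δK = δK := fun g => by rw [hρ, hδW]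
  have hcommδ : ∀ v, ∃ u, Θ (R.y v) * Θ δH - Θ δH * Θ (R.y v) = LinearMap.mulLeft ℂ u := by
    intro v
    let N : Submodule ℂ (Module.End ℂ (LocReg δP)) :=
      (LinearMap.range (LinearMap.mul ℂ (LocReg δP))).comap
        (LinearMap.mulRight ℂ (Θ δH) - LinearMap.mulLeft ℂ (Θ δH))
    suffices Θ (R.y v) ∈ N by
      obtain ⟨u, hu⟩ := this
      exact ⟨u, hu.symm⟩
    rw [hΘy']
    refine add_mem (sum_mem fun i _ => Submodule.smul_mem _ _ ⟨Dext i δK, ?_⟩)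
      (sum_mem fun s _ => Submodule.smul_mem _ _ ⟨0, ?_⟩)
    · ext u
      simp [hδHΘ, hLeib, mul_comm]
    · ext u
      simp [hδHΘ, hρδ]
      ring
  set S : Set (Module.End ℂ (LocReg δP)) :=
    Set.range (fun f : LocReg δP => LinearMap.mulLeft ℂ f) ∪ Set.range Dext ∪
      Set.range (fun g : G.W => (ρ g).toLinearMap)
  have hmem : ∀ h : R.H, Θ h ∈ Algebra.adjoin ℂ S := by
    have h1 (u : LocReg δP) : LinearMap.mulLeft ℂ u ∈ Algebra.adjoin ℂ S :=
      Algebra.subset_adjoin (Or.inl (Or.inl ⟨u, rfl⟩))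
    have h2 (i : Fin n) : Dext i ∈ Algebra.adjoin ℂ S :=
      Algebra.subset_adjoin (Or.inl (Or.inr ⟨i, rfl⟩))
    have h3 (g : G.W) : (ρ g).toLinearMap ∈ Algebra.adjoin ℂ S :=
      Algebra.subset_adjoin (Or.inr ⟨g, rfl⟩)
    intro h
    induction h using R.induction with
    | x a => rw [hΘx]; exact h1 _
    | y v =>
      rw [hΘy']
      exact add_mem (sum_mem fun i _ => Subalgebra.smul_mem _ (h2 i) _)
        (sum_mem fun s _ => Subalgebra.smul_mem _
          (mul_mem (h1 _) (sub_mem (h3 s.1) (one_mem _))) _)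
    | w g => rw [hΘw]; exact h3 g
    | algebraMap z => rw [AlgHom.commutes]; exact Subalgebra.algebraMap_mem _ z
    | add h k hh hk => rw [map_add]; exact add_mem hh hk
    | mul h k hh hk => rw [map_mul]; exact mul_mem hh hk
  obtain ⟨w, hw⟩ := (show IsUnit δK from LocReg.isUnit δP).exists_right_inv
  have hw1 : Θ δH * LinearMap.mulLeft ℂ w = 1 := by
    rw [hδHΘ]
    ext u
    change δK * (w * u) = u
    rw [← mul_assoc, hw, one_mul]
  have hw2 : LinearMap.mulLeft ℂ w * Θ δH = 1 := by
    rw [hδHΘ]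
    ext u
    change w * (δK * u) = u
    rw [← mul_assoc, mul_comm w, hw, one_mul]
  refine ⟨hΘinj, hmem, ⟨⟨_, _, hw1, hw2⟩, rfl⟩, ?_, fun a ha => ?_⟩
  · rw [show Ring.inverse (Θ δH) = LinearMap.mulLeft ℂ w from
      Ring.inverse_unit (⟨_, _, hw1, hw2⟩ : (Module.End ℂ (LocReg δP))ˣ)]
    exact Algebra.subset_adjoin (Or.inl (Or.inl ⟨w, rfl⟩))
  have hΔx : ∀ p : PolyV n, R.polyX b p * δH = δH * R.polyX b p := fun p => hΘinj (by
    rw [map_mul, map_mul, R.map_polyX b Θ hΘx, hδHΘ]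
    ext u
    exact mul_left_comm (algebraMap (PolyV n) (LocReg δP) p) δK u)
  have ore := R.ore (fun a => by rw [← R.polyX_dualPoly b]; exact hΔx _)
    (fun g => hδHW g) fun v => ⟨R.y v * δH - δH * R.y v, by abel, hΘinj (by
      obtain ⟨u, hu⟩ := hcommδ v
      simp only [map_mul, map_sub]
      rw [hu, hδHΘ]
      ext f
      exact mul_left_comm u δK f)⟩
  have hfrac : ∀ u : LocReg δP, ∃ (k : ℕ) (p : PolyV n),
      LinearMap.mulLeft ℂ u * Θ δH ^ k = Θ (R.polyX b p) := fun u => by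
    obtain ⟨k, p, hp⟩ := LocReg.exists_mul_pow u
    refine ⟨k, p, ?_⟩
    rw [R.map_polyX b Θ hΘx, ← hp, hδHΘ, LinearMap.pow_mulLeft]
    ext v
    simp [hδK]
  have hwfrac : ∀ g : G.W, ∃ (h : R.H) (k : ℕ), (ρ g).toLinearMap * Θ δH ^ k = Θ h := fun g =>
    ⟨R.w g, 0, by rw [pow_zero, mul_one, hΘw]⟩
  have hAfrac : ∀ v, ∃ (h : R.H) (k : ℕ), A v * Θ δH ^ k = Θ h := fun v => by
    have hA : A v ∈ Algebra.adjoin ℂ (Set.range (fun f : LocReg δP => LinearMap.mulLeft ℂ f) ∪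
        Set.range (fun g : G.W => (ρ g).toLinearMap)) := by
      refine sum_mem fun s _ => Subalgebra.smul_mem _ (mul_mem ?_ (sub_mem ?_ (one_mem _))) _
      · exact Algebra.subset_adjoin (Or.inl ⟨_, rfl⟩)
      · exact Algebra.subset_adjoin (Or.inr ⟨s.1, rfl⟩)
    refine exists_mul_pow_eq_of_mem_adjoin Θ δH ore ?_ hA
    rintro _ (⟨u, rfl⟩ | ⟨g, rfl⟩)
    · obtain ⟨k, p, hp⟩ := hfrac u
      exact ⟨_, k, hp⟩
    · exact hwfrac g
  refine exists_mul_pow_eq_of_mem_adjoin Θ δH ore ?_ ha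
  rintro _ ((⟨u, rfl⟩ | ⟨i, rfl⟩) | ⟨g, rfl⟩)
  · obtain ⟨k, p, hp⟩ := hfrac u
    exact ⟨_, k, hp⟩
  · obtain ⟨h, k, hA⟩ := hAfrac (b i)
    refine ⟨R.y (b i) * δH ^ k - h, k, ?_⟩
    rw [eq_sub_of_add_eq (hΘb i).symm, sub_mul, hA]
    simp
  · exact hwfrac g

end
end Stmt9
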